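/- arXiv:2409.04129 — 3 statements merged into one kernel-verified Lean document; each statement's English description precedes it below -/
import Mathlib

section
/- Let n ≥ 1 be an integer, γ ∈ (1,(n+2)/n], κ > 0 and τ > 0. Let f₀ : ℝ²ⁿ → [0,∞) be measurable with ∬(1+|v|²) f₀ dx dv < ∞, and let f : [0,∞)×ℝⁿ×ℝⁿ → [0,∞) be measurable with sup_{t≥0} ∬(1+|v|²) f(t,x,v) dx dv < ∞, such that for every t ≥ 0 and a.e. (x,v), f(t,x,v) = e^{−t/τ} f₀(x−vt,v) + (1/τ)∫₀^t e^{−(t−s)/τ} M[f(s,x−v(t−s),·)](v) ds. Then f is a distributional solution: for every T > 0 and every φ ∈ C_c^1([0,T)×ℝ²ⁿ), writing φ₀ = φ(0,·,·), one has −∬ f₀ φ₀ dx dv − ∫₀^T ∬ f (∂_tφ + v·∇ₓφ) dx dv dt = (1/τ)∫₀^T ∬ ( M[f(t,x,·)](v) − f(t,x,v) ) φ(t,x,v) dx dv dt. -/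
open MeasureTheory Real

noncomputable section

abbrev En (n : ℕ) := EuclideanSpace ℝ (Fin n)

/-- degree of freedom `d = 2/(γ-1) - n`. -/
def dof (n : ℕ) (γ : ℝ) : ℝ := 2 / (γ - 1) - n

/-- the constant `c₁ = 2γκ/(γ-1)`. -/
def cc1 (γ κ : ℝ) : ℝ := 2 * γ * κ / (γ - 1)

/-- the constant `c₂ = (2γκ/(γ-1))^{-1/(γ-1)} Γ(γ/(γ-1)) / (π^{n/2} Γ(d/2+1))`. -/
def cc2 (n : ℕ) (γ κ : ℝ) : ℝ :=
  (2 * γ * κ / (γ - 1)) ^ (-(1 / (γ - 1))) * Real.Gamma (γ / (γ - 1)) /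
    (Real.pi ^ ((n : ℝ) / 2) * Real.Gamma (dof n γ / 2 + 1))

/-- the Maxwellian: `M[ρ,u](v) = c₂ (c₁ ρ^{γ-1} - |v-u|²)₊^{d/2}` if `γ < (n+2)/n`,
and `M[ρ,u](v) = c₂·1_{c₁ ρ^{2/n} ≥ |v-u|²}` if `γ = (n+2)/n`. -/
def MaxwG (n : ℕ) (γ κ ρ : ℝ) (u v : En n) : ℝ :=
  if γ = ((n : ℝ) + 2) / n then
    (if ‖v - u‖ ^ 2 ≤ cc1 γ κ * ρ ^ (2 / (n : ℝ)) then cc2 n γ κ else 0)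
  else cc2 n γ κ * (max (cc1 γ κ * ρ ^ (γ - 1) - ‖v - u‖ ^ 2) 0) ^ (dof n γ / 2)

/-- macroscopic density `ρ_f = ∫ f dv`. -/
def densF (n : ℕ) (f : En n → ℝ) : ℝ := ∫ v, f v

/-- bulk velocity `u_f = ρ_f⁻¹ ∫ v f dv` if `ρ_f ≠ 0`, else `0`. -/
def bulkF (n : ℕ) (f : En n → ℝ) : En n :=
  if densF n f = 0 then 0 else (densF n f)⁻¹ • ∫ v, f v • v

/-- the Maxwellian `M[f] = M[ρ_f, u_f]` of a velocity profile `f`. -/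
def MaxwGOf (n : ℕ) (γ κ : ℝ) (f : En n → ℝ) (v : En n) : ℝ :=
  MaxwG n γ κ (densF n f) (bulkF n f) v

open Set Filter Topology

/-- Integration by parts for the one-dimensional Duhamel formula. -/
lemma duhamel_by_parts {τ T a : ℝ} (hT : 0 < T) {N g ψ : ℝ → ℝ}
    (hN : IntervalIntegrable N volume 0 T) (hψ : ContDiff ℝ 1 ψ) (hψT : ψ T = 0)
    (hg : ∀ᵐ t, t ∈ Ioc 0 T → g t = Real.exp (-t / τ) * a +
      (1 / τ) * ∫ s in (0:ℝ)..t, Real.exp (-(t - s) / τ) * N s) :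
    -(a * ψ 0) - ∫ t in (0:ℝ)..T, g t * deriv ψ t =
      (1 / τ) * ∫ t in (0:ℝ)..T, (N t - g t) * ψ t := by
  set w : ℝ → ℝ := fun s => Real.exp (s / τ) * N s with hw
  have hwint : IntervalIntegrable w volume 0 T :=
    hN.continuousOn_mul (by fun_prop)
  set h : ℝ → ℝ := fun t => a + (1 / τ) * ∫ s in (0:ℝ)..t, w s with hh
  set χ : ℝ → ℝ := fun t => Real.exp (-t / τ) * ψ t with hχ
  have hH := hwint.absolutelyContinuousOnInterval_intervalIntegral (c := 0) (by simp)
  have hhac : AbsolutelyContinuousOnInterval h 0 T :=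
    ((contDiff_const (c := a)).contDiffOn.absolutelyContinuousOnInterval).add (hH.const_mul _)
  have hχC : ContDiff ℝ 1 χ := by
    have : ContDiff ℝ 1 (fun t : ℝ => Real.exp (-t / τ)) := by fun_prop
    exact this.mul hψ
  have key := hhac.integral_deriv_mul_eq_sub hχC.contDiffOn.absolutelyContinuousOnInterval
  have hψ' : Continuous (deriv ψ) := hψ.continuous_deriv le_rfl
  have hgh : ∀ᵐ t, t ∈ Ioc 0 T → g t = Real.exp (-t / τ) * h t := by
    filter_upwards [hg] with t ht hmem
    rw [ht hmem, hh]
    have : ∀ s, Real.exp (-(t - s) / τ) * N s = Real.exp (-t / τ) * w s := fun s => by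
      rw [hw, ← mul_assoc, ← Real.exp_add]
      congr 2
      ring
    simp_rw [this]
    rw [intervalIntegral.integral_const_mul]
    ring
  have hgint : IntervalIntegrable g volume 0 T := by
    have hc : IntervalIntegrable (fun t => Real.exp (-t / τ) * h t) volume 0 T :=
      (ContinuousOn.mul (by fun_prop) hhac.continuousOn).intervalIntegrable
    refine hc.congr_ae ?_
    rw [Filter.EventuallyEq, ae_restrict_iff' measurableSet_uIoc, uIoc_of_le hT.le]
    filter_upwards [hgh] with t ht hm using (ht hm).symm
  have hcongr : ∫ t in (0:ℝ)..T, deriv h t * χ t + h t * deriv χ t =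
      ∫ t in (0:ℝ)..T, (g t * deriv ψ t + (1 / τ) * ((N t - g t) * ψ t)) := by
    apply intervalIntegral.integral_congr_ae
    filter_upwards [hgh, hwint.ae_hasDerivAt_integral] with t h1 h2 hm
    rw [uIoc_of_le hT.le] at hm
    have hm' : t ∈ uIcc 0 T := by
      rw [uIcc_of_le hT.le]; exact Ioc_subset_Icc_self hm
    have hd : HasDerivAt h ((1 / τ) * w t) t :=
      ((h2 hm' 0 (by simp)).const_mul (1 / τ)).const_add a
    have he : HasDerivAt (fun t : ℝ => Real.exp (-t / τ)) (Real.exp (-t / τ) * (-1 / τ)) t :=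
      ((hasDerivAt_id t).neg.div_const τ).exp
    have hdχ : HasDerivAt χ (Real.exp (-t / τ) * (-1 / τ) * ψ t +
        Real.exp (-t / τ) * deriv ψ t) t :=
      he.mul ((hψ.differentiable one_ne_zero) t).hasDerivAt
    rw [hd.deriv, hdχ.deriv, h1 hm, hw, hχ]
    have : Real.exp (t / τ) * Real.exp (-t / τ) = 1 := by
      rw [← Real.exp_add, ← Real.exp_zero]; congr 1; ring
    linear_combination (1 / τ * N t * ψ t) * this
  rw [hcongr, intervalIntegral.integral_add, intervalIntegral.integral_const_mul] at key
  · have h0 : h 0 = a := by simp [hh]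
    have hχ0 : χ 0 = ψ 0 := by simp [hχ]
    have hχT : χ T = 0 := by simp [hχ, hψT]
    rw [h0, hχ0, hχT] at key
    linarith
  · exact hgint.mul_continuousOn hψ'.continuousOn
  · exact ((hN.sub hgint).mul_continuousOn hψ.continuous.continuousOn).const_mul _

/-- Free transport `(t, (x, v)) ↦ (t, (x + t v, v))`. -/
def freeTransport (n : ℕ) (q : ℝ × (En n × En n)) : ℝ × (En n × En n) :=
  (q.1, (q.2.1 + q.1 • q.2.2, q.2.2))

lemma continuous_freeTransport (n : ℕ) : Continuous (freeTransport n) := by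
  unfold freeTransport; fun_prop

lemma measurePreserving_shear (n : ℕ) (t : ℝ) :
    MeasurePreserving (fun p : En n × En n => (p.1 + t • p.2, p.2)) := by
  have h : MeasurePreserving (fun q : En n × En n => (q.1, q.2 + t • q.1))
      (volume.prod volume) (volume.prod volume) :=
    (MeasurePreserving.id volume).skew_product (g := fun v x => x + t • v) (by fun_prop)
      (Eventually.of_forall fun v => map_add_right_eq_self volume (t • v))
  exact (Measure.measurePreserving_swap.comp h).comp Measure.measurePreserving_swap

lemma measurePreserving_freeTransport (n : ℕ) (μ : Measure ℝ) [SFinite μ] :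
    MeasurePreserving (freeTransport n) (μ.prod volume) (μ.prod volume) :=
  (MeasurePreserving.id μ).skew_product
    (g := fun t (p : En n × En n) => (p.1 + t • p.2, p.2))
    (by fun_prop)
    (Eventually.of_forall fun t => (measurePreserving_shear n t).map_eq)

lemma integral_shear (n : ℕ) (t : ℝ) (F : En n × En n → ℝ) :
    ∫ p : En n × En n, F (p.1 + t • p.2, p.2) = ∫ p, F p := by
  refine (measurePreserving_shear n t).integral_comp ?_ F
  let e : En n × En n ≃ₜ En n × En n :=
    { toFun := fun p => (p.1 + t • p.2, p.2)
      invFun := fun p => (p.1 - t • p.2, p.2)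
      left_inv := fun p => by simp
      right_inv := fun p => by simp
      continuous_toFun := by fun_prop
      continuous_invFun := by fun_prop }
  exact e.measurableEmbedding

lemma hasDerivAt_comp_freeTransport {n : ℕ} {φ : ℝ × (En n × En n) → ℝ}
    (hφ : ContDiff ℝ 1 φ) (p : En n × En n) (t : ℝ) :
    HasDerivAt (fun t => φ (freeTransport n (t, p)))
      (fderiv ℝ φ (freeTransport n (t, p)) (1, (p.2, 0))) t := by
  have h1 : HasDerivAt (fun t : ℝ => p.1 + t • p.2) p.2 t := by
    simpa using ((hasDerivAt_id t).smul_const p.2).const_add p.1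
  have h2 : HasDerivAt (fun t : ℝ => freeTransport n (t, p)) (1, (p.2, 0)) t :=
    (hasDerivAt_id t).prodMk (h1.prodMk (hasDerivAt_const t p.2))
  exact ((hφ.differentiable one_ne_zero) _).hasFDerivAt.comp_hasDerivAt t h2

/-- The velocity integral of a Maxwellian is controlled by its density. -/
lemma lintegral_MaxwG_le (n : ℕ) (hn : 1 ≤ n) (γ κ : ℝ) (hγ1 : 1 < γ)
    (hγ2 : γ ≤ ((n : ℝ) + 2) / n) (hκ : 0 < κ) :
    ∃ K : NNReal, ∀ (ρ : ℝ) (u : En n), 0 ≤ ρ →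
      ∫⁻ v, ‖MaxwG n γ κ ρ u v‖ₑ ≤ K * ENNReal.ofReal ρ := by
  have hn0 : (0:ℝ) < n := by exact_mod_cast hn
  have hγ0 : 0 < γ - 1 := by linarith
  have hc1 : 0 < cc1 γ κ := by unfold cc1; positivity
  have hd : 0 ≤ dof n γ := by
    rw [dof, sub_nonneg, le_div_iff₀ hγ0]
    rw [le_div_iff₀ hn0] at hγ2
    linarith
  set B : ℝ := cc1 γ κ ^ (1 / (γ - 1)) with hB
  have hB0 : 0 ≤ B := by positivity
  refine ⟨(|cc2 n γ κ| * B).toNNReal * (volume (Metric.ball (0 : En n) 1)).toNNReal, ?_⟩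
  intro ρ u hρ
  set R : ℝ := cc1 γ κ * ρ ^ (γ - 1) with hR
  have hR0 : 0 ≤ R := by positivity
  have hpt : ∀ v, ‖MaxwG n γ κ ρ u v‖ₑ ≤
      (Metric.closedBall u (√R)).indicator
        (fun _ => ENNReal.ofReal (|cc2 n γ κ| * R ^ (dof n γ / 2))) v := by
    intro v
    by_cases hv : v ∈ Metric.closedBall u (√R)
    · rw [indicator_of_mem hv, Real.enorm_eq_ofReal_abs]
      apply ENNReal.ofReal_le_ofReal
      unfold MaxwG
      split_ifs with h1 h2
      · have : dof n γ = 0 := by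
          rw [dof, h1]; field_simp; ring
        simp [this]
      · rw [abs_zero]; positivity
      · rw [abs_mul]
        gcongr
        rw [abs_of_nonneg (by positivity)]
        gcongr
        exact max_le (by linarith [sq_nonneg ‖v - u‖]) hR0
    · rw [indicator_of_notMem hv]
      have hlt : R < ‖v - u‖ ^ 2 := by
        rw [Metric.mem_closedBall, dist_eq_norm, not_le] at hv
        exact (Real.sqrt_lt' (lt_of_le_of_lt (Real.sqrt_nonneg _) hv)).1 hv
      have : MaxwG n γ κ ρ u v = 0 := by
        unfold MaxwG
        split_ifs with h1 h2
        · have : γ - 1 = 2 / n := by rw [h1]; field_simp; ring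
          rw [← this] at h2
          linarith
        · rfl
        · have hne : dof n γ / 2 ≠ 0 := by
            intro h0
            apply h1
            have h0 : 2 / (γ - 1) = n := by unfold dof at h0; linarith
            rw [div_eq_iff hγ0.ne'] at h0
            rw [eq_div_iff hn0.ne']
            linarith
          rw [max_eq_right (by linarith), Real.zero_rpow hne, mul_zero]
      simp [this]
  have hpow : R ^ (dof n γ / 2) * √R ^ n = B * ρ := by
    have h1 : √R ^ n = R ^ ((n:ℝ) / 2) := by
      rw [Real.sqrt_eq_rpow, ← Real.rpow_natCast, ← Real.rpow_mul hR0]; congr 1; ring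
    have h2 : dof n γ / 2 + (n:ℝ) / 2 = 1 / (γ - 1) := by unfold dof; ring
    rw [h1, ← Real.rpow_add_of_nonneg hR0 (by positivity) (by positivity), h2, hR,
      Real.mul_rpow hc1.le (by positivity), ← Real.rpow_mul hρ, mul_one_div_cancel hγ0.ne',
      Real.rpow_one]
  calc ∫⁻ v, ‖MaxwG n γ κ ρ u v‖ₑ
      ≤ ENNReal.ofReal (|cc2 n γ κ| * R ^ (dof n γ / 2)) * volume (Metric.closedBall u (√R)) := by
        refine (lintegral_mono hpt).trans ?_
        rw [lintegral_indicator_const Metric.isClosed_closedBall.measurableSet]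
    _ = _ := by
        rw [Measure.addHaar_closedBall _ _ (Real.sqrt_nonneg _), ← mul_assoc,
          ← ENNReal.ofReal_mul (by positivity), finrank_euclideanSpace_fin, mul_assoc, hpow,
          ← mul_assoc, ENNReal.ofReal_mul (by positivity), ENNReal.coe_mul,
          ENNReal.coe_toNNReal measure_ball_lt_top.ne]
        rw [mul_right_comm]; rfl

lemma measurable_MaxwGOf (n : ℕ) (γ κ : ℝ) {f : ℝ → En n × En n → ℝ}
    (hf : Measurable (Function.uncurry f)) :
    Measurable (fun q : ℝ × (En n × En n) =>
      MaxwGOf n γ κ (fun w => f q.1 (q.2.1, w)) q.2.2) := by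
  have hg : Measurable (fun z : (ℝ × (En n × En n)) × En n => f z.1.1 (z.1.2.1, z.2)) :=
    hf.comp (g := Function.uncurry f) (f := fun z : (ℝ × (En n × En n)) × En n =>
      (z.1.1, (z.1.2.1, z.2))) (by fun_prop)
  have hρ : Measurable (fun q : ℝ × (En n × En n) => densF n (fun w => f q.1 (q.2.1, w))) :=
    hg.stronglyMeasurable.integral_prod_right'.measurable
  have hu' : Measurable (fun q : ℝ × (En n × En n) => ∫ w, f q.1 (q.2.1, w) • w) :=
    (hg.smul measurable_snd).stronglyMeasurable.integral_prod_right'.measurable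
  have hu : Measurable (fun q : ℝ × (En n × En n) => bulkF n (fun w => f q.1 (q.2.1, w))) := by
    unfold bulkF
    exact Measurable.ite (hρ (measurableSet_singleton 0)) measurable_const (hρ.inv.smul hu')
  unfold MaxwGOf MaxwG
  split_ifs
  · refine Measurable.ite (measurableSet_le ?_ ?_) measurable_const measurable_const <;> fun_prop
  · fun_prop

/-- The local Maxwellian of a bounded-mass density is integrable on bounded time intervals. -/
lemma integrable_MaxwGOf (n : ℕ) (hn : 1 ≤ n) (γ κ : ℝ) (hγ1 : 1 < γ)
    (hγ2 : γ ≤ ((n : ℝ) + 2) / n) (hκ : 0 < κ) {f : ℝ → En n × En n → ℝ}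
    (hf : Measurable (Function.uncurry f)) (hf0 : ∀ t p, 0 ≤ f t p) {μ : Measure ℝ} [SFinite μ]
    (hfi : Integrable (Function.uncurry f) (μ.prod volume)) :
    Integrable (fun q : ℝ × (En n × En n) =>
      MaxwGOf n γ κ (fun w => f q.1 (q.2.1, w)) q.2.2) (μ.prod volume) := by
  obtain ⟨K, hK⟩ := lintegral_MaxwG_le n hn γ κ hγ1 hγ2 hκ
  have hm := measurable_MaxwGOf n γ κ hf
  refine ⟨hm.aestronglyMeasurable, ?_⟩
  have hfin := hfi.2
  rw [HasFiniteIntegral, lintegral_prod _ hf.enorm.aemeasurable] at hfin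
  rw [HasFiniteIntegral, lintegral_prod _ hm.enorm.aemeasurable]
  have hx : ∀ t x, ∫⁻ v, ‖MaxwGOf n γ κ (fun w => f t (x, w)) v‖ₑ ≤
      K * ∫⁻ v, ‖f t (x, v)‖ₑ := fun t x => by
    have h0 : 0 ≤ densF n (fun w => f t (x, w)) := integral_nonneg fun w => hf0 _ _
    refine (hK _ _ h0).trans ?_
    gcongr
    refine (Real.enorm_of_nonneg h0).symm.le.trans ?_
    exact enorm_integral_le_lintegral_enorm _
  refine lt_of_le_of_lt ?_ (ENNReal.mul_lt_top (ENNReal.coe_lt_top (r := K)) hfin)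
  rw [← lintegral_const_mul _ (by
    exact Measurable.lintegral_prod_right' (f := fun q : ℝ × (En n × En n) =>
      ‖Function.uncurry f q‖ₑ) (by fun_prop))]
  refine lintegral_mono fun t => ?_
  have hmt : Measurable fun p : En n × En n =>
      ‖MaxwGOf n γ κ (fun w => f t (p.1, w)) p.2‖ₑ :=
    (hm.comp (measurable_prodMk_left (x := t))).enorm
  have hft : Measurable (f t) := hf.of_uncurry_left
  simp only [Function.uncurry]
  change ∫⁻ p : En n × En n, ‖MaxwGOf n γ κ (fun w => f t (p.1, w)) p.2‖ₑ ≤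
    K * ∫⁻ p : En n × En n, ‖f t p‖ₑ
  rw [Measure.volume_eq_prod, lintegral_prod _ hmt.aemeasurable,
    lintegral_prod _ hft.enorm.aemeasurable, ← lintegral_const_mul _
      (hft.enorm.lintegral_prod_right')]
  exact lintegral_mono fun x => hx t x

/-- Fubini's theorem along the characteristics of free transport. -/
lemma integral_integral_freeTransport (n : ℕ) {T : ℝ} (hT : 0 ≤ T)
    {F : ℝ × (En n × En n) → ℝ}
    (hF : Integrable F ((volume.restrict (Ioc 0 T)).prod volume)) :
    Integrable (fun p => ∫ t in (0:ℝ)..T, F (freeTransport n (t, p))) ∧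
    ∫ t in (0:ℝ)..T, ∫ p, F (t, p) = ∫ p, ∫ t in (0:ℝ)..T, F (freeTransport n (t, p)) := by
  have hFS := (measurePreserving_freeTransport n _).integrable_comp_of_integrable hF
  simp_rw [intervalIntegral.integral_of_le hT]
  refine ⟨hFS.integral_prod_right, ?_⟩
  rw [← integral_integral_swap (f := fun t p => F (freeTransport n (t, p))) hFS]
  congr 1
  ext t
  exact (integral_shear n t fun p => F (t, p)).symm

/-- A density whose energy-weighted mass is bounded uniformly in time is integrable on
bounded time intervals. -/
lemma integrable_uncurry_of_moment_bound (n : ℕ) {T C : ℝ} {f : ℝ → En n × En n → ℝ}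
    (hf : Measurable (Function.uncurry f)) (hf0 : ∀ t p, 0 ≤ f t p)
    (hC : ∀ t : ℝ, 0 ≤ t →
      Integrable (fun p : En n × En n => (1 + ‖p.2‖ ^ 2) * f t p) ∧
      (∫ p : En n × En n, (1 + ‖p.2‖ ^ 2) * f t p) ≤ C) :
    Integrable (Function.uncurry f) ((volume.restrict (Ioc 0 T)).prod volume) := by
  refine ⟨hf.aestronglyMeasurable, ?_⟩
  rw [HasFiniteIntegral, lintegral_prod _ hf.enorm.aemeasurable]
  calc ∫⁻ t in Ioc 0 T, ∫⁻ p, ‖Function.uncurry f (t, p)‖ₑ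
      ≤ ∫⁻ _ in Ioc 0 T, ENNReal.ofReal C := by
        refine setLIntegral_mono measurable_const fun t ht => ?_
        obtain ⟨h1, h2⟩ := hC t ht.1.le
        have h0 : ∀ p : En n × En n, 0 ≤ (1 + ‖p.2‖ ^ 2) * f t p :=
          fun p => mul_nonneg (by positivity) (hf0 t p)
        refine le_trans ?_ (ENNReal.ofReal_le_ofReal h2)
        rw [ofReal_integral_eq_lintegral_ofReal h1 (Eventually.of_forall h0)]
        refine lintegral_mono fun p => ?_
        rw [Function.uncurry_apply_pair, Real.enorm_of_nonneg (hf0 t p)]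
        exact ENNReal.ofReal_le_ofReal
          (le_mul_of_one_le_left (hf0 t p) (by linarith [sq_nonneg ‖p.2‖]))
    _ < ⊤ := by
        rw [setLIntegral_const]
        exact ENNReal.mul_lt_top ENNReal.ofReal_lt_top measure_Ioc_lt_top

/-- Almost every characteristic satisfies the Duhamel formula at almost every time. -/
lemma ae_characteristic_of_mild (n : ℕ) {τ : ℝ} {f₀ : En n × En n → ℝ}
    (hf₀ : Measurable f₀) {f M : ℝ × (En n × En n) → ℝ} (hf : Measurable f) (hM : Measurable M)
    (hmild : ∀ t : ℝ, 0 ≤ t → ∀ᵐ p : En n × En n,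
      f (t, p) = Real.exp (-t / τ) * f₀ (p.1 - t • p.2, p.2) +
        (1 / τ) * ∫ s in (0:ℝ)..t,
          Real.exp (-(t - s) / τ) * M (s, (p.1 - (t - s) • p.2, p.2))) :
    ∀ᵐ p : En n × En n, ∀ᵐ t : ℝ, 0 ≤ t →
      f (freeTransport n (t, p)) = Real.exp (-t / τ) * f₀ p +
        (1 / τ) * ∫ s in (0:ℝ)..t,
          Real.exp (-(t - s) / τ) * M (freeTransport n (s, p)) := by
  have hS : Measurable (freeTransport n) := (continuous_freeTransport n).measurable
  set J : ℝ × (En n × En n) → ℝ := fun q =>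
    ∫ s : ℝ, if 0 < s ∧ s ≤ q.1 then
      Real.exp (-(q.1 - s) / τ) * M (freeTransport n (s, q.2)) else 0 with hJ
  have hJm : Measurable J := by
    refine (StronglyMeasurable.integral_prod_right' (f := fun z : (ℝ × (En n × En n)) × ℝ =>
      if 0 < z.2 ∧ z.2 ≤ z.1.1 then
        Real.exp (-(z.1.1 - z.2) / τ) * M (freeTransport n (z.2, z.1.2)) else 0)
      (Measurable.stronglyMeasurable ?_)).measurable
    refine Measurable.ite ?_ (by fun_prop) measurable_const
    exact (measurableSet_lt measurable_const measurable_snd).inter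
      (measurableSet_le measurable_snd (by fun_prop))
  have hJeq : ∀ t : ℝ, 0 ≤ t → ∀ p, J (t, p) = ∫ s in (0:ℝ)..t,
      Real.exp (-(t - s) / τ) * M (freeTransport n (s, p)) := fun t ht p => by
    rw [intervalIntegral.integral_of_le ht, ← integral_indicator measurableSet_Ioc]
    refine integral_congr_ae (Eventually.of_forall fun s => ?_)
    simp only [indicator_apply, mem_Ioc]
  have hswap : ∀ᵐ p : En n × En n, ∀ᵐ t : ℝ, 0 ≤ t →
      f (freeTransport n (t, p)) = Real.exp (-t / τ) * f₀ p + (1 / τ) * J (t, p) := by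
    refine (Measure.ae_ae_comm (p := fun (t : ℝ) (p : En n × En n) => 0 ≤ t →
      f (freeTransport n (t, p)) =
        Real.exp (-t / τ) * f₀ p + (1 / τ) * J (t, p)) ?_).1 ?_
    · have h1 : MeasurableSet {q : ℝ × (En n × En n) | ¬ 0 ≤ q.1} :=
        (measurableSet_le measurable_const measurable_fst).compl
      have h2 : MeasurableSet {q : ℝ × (En n × En n) | f (freeTransport n q) =
          Real.exp (-q.1 / τ) * f₀ q.2 + (1 / τ) * J q} :=
        measurableSet_eq_fun (by fun_prop) (by fun_prop)
      convert h1.union h2 using 1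
      ext q
      simp only [mem_ofPred_eq, mem_union, imp_iff_not_or]
    · refine Eventually.of_forall fun t => ?_
      by_cases ht : 0 ≤ t
      · filter_upwards [(measurePreserving_shear n t).quasiMeasurePreserving.ae (hmild t ht)]
          with p hp _
        rw [hJeq t ht]
        simp only [freeTransport]
        rw [hp, add_sub_cancel_right]
        have h3 : ∀ s : ℝ, p.1 + t • p.2 - (t - s) • p.2 = p.1 + s • p.2 := fun s => by
          rw [sub_smul]; abel
        simp_rw [h3]
      · exact Eventually.of_forall fun p h => absurd h ht
  filter_upwards [hswap] with p hp
  filter_upwards [hp] with t ht h0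
  rw [ht h0, hJeq t h0]

/-- Appendix C: every mild solution of the BGK model is a distributional solution. -/
theorem stmt10 (n : ℕ) (hn : 1 ≤ n) (γ κ τ : ℝ)
    (hγ1 : 1 < γ) (hγ2 : γ ≤ ((n : ℝ) + 2) / n) (hκ : 0 < κ) (hτ : 0 < τ)
    (f₀ : En n × En n → ℝ) (hf₀meas : Measurable f₀) (hf₀nonneg : ∀ p, 0 ≤ f₀ p)
    (hf₀int : Integrable (fun p : En n × En n => (1 + ‖p.2‖ ^ 2) * f₀ p))
    (f : ℝ → En n × En n → ℝ)
    (hfmeas : Measurable (Function.uncurry f))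
    (hfnonneg : ∀ t p, 0 ≤ f t p)
    (hfbdd : ∃ C : ℝ, ∀ t : ℝ, 0 ≤ t →
      Integrable (fun p : En n × En n => (1 + ‖p.2‖ ^ 2) * f t p) ∧
      (∫ p : En n × En n, (1 + ‖p.2‖ ^ 2) * f t p) ≤ C)
    -- mild form
    (hmild : ∀ t : ℝ, 0 ≤ t → ∀ᵐ p : En n × En n,
      f t p = Real.exp (-t / τ) * f₀ (p.1 - t • p.2, p.2) +
        (1 / τ) * ∫ s in (0:ℝ)..t,
          Real.exp (-(t - s) / τ) *
            MaxwGOf n γ κ (fun w => f s (p.1 - (t - s) • p.2, w)) p.2) :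
    -- conclusion: weak (distributional) formulation
    ∀ T : ℝ, 0 < T → ∀ φ : ℝ × (En n × En n) → ℝ,
      ContDiff ℝ 1 φ → HasCompactSupport φ →
      tsupport φ ⊆ Set.Iio T ×ˢ (Set.univ : Set (En n × En n)) →
      -(∫ p : En n × En n, f₀ p * φ (0, p)) -
          (∫ t in (0:ℝ)..T, ∫ p : En n × En n,
            f t p * fderiv ℝ φ (t, p) (1, (p.2, 0))) =
        (1 / τ) * ∫ t in (0:ℝ)..T, ∫ p : En n × En n,
          (MaxwGOf n γ κ (fun w => f t (p.1, w)) p.2 - f t p) * φ (t, p) := by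
  intro T hT φ hφ hφc hφs
  obtain ⟨C, hC⟩ := hfbdd
  set M : ℝ × (En n × En n) → ℝ := fun q =>
    MaxwGOf n γ κ (fun w => f q.1 (q.2.1, w)) q.2.2 with hM
  set D : ℝ × (En n × En n) → ℝ := fun q => fderiv ℝ φ q (1, (q.2.2, 0)) with hD
  have hfi := integrable_uncurry_of_moment_bound n (T := T) hfmeas hfnonneg hC
  have hMm : Measurable M := measurable_MaxwGOf n γ κ hfmeas
  have hMi : Integrable M ((volume.restrict (Ioc 0 T)).prod volume) :=
    integrable_MaxwGOf n hn γ κ hγ1 hγ2 hκ hfmeas hfnonneg hfi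
  have hDcont : Continuous D :=
    (hφ.continuous_fderiv one_ne_zero).clm_apply (by fun_prop)
  have hDc : HasCompactSupport D :=
    (hφc.fderiv ℝ).mono' fun q hq => subset_tsupport _ fun h0 => hq (by
      change fderiv ℝ φ q _ = 0
      rw [h0]; rfl)
  obtain ⟨bφ, hbφ⟩ := hφ.continuous.bounded_above_of_compact_support hφc
  obtain ⟨bD, hbD⟩ := hDcont.bounded_above_of_compact_support hDc
  have hfD : Integrable (fun q => Function.uncurry f q * D q)
      ((volume.restrict (Ioc 0 T)).prod volume) :=
    hfi.mul_bdd hDcont.aestronglyMeasurable (Eventually.of_forall hbD)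
  have hMfφ : Integrable (fun q => (M q - Function.uncurry f q) * φ q)
      ((volume.restrict (Ioc 0 T)).prod volume) :=
    (hMi.sub hfi).mul_bdd hφ.continuous.aestronglyMeasurable (Eventually.of_forall hbφ)
  have hf₀i : Integrable f₀ := by
    refine hf₀int.mono hf₀meas.aestronglyMeasurable (Eventually.of_forall fun p => ?_)
    rw [norm_mul]
    refine le_mul_of_one_le_left (norm_nonneg _) ?_
    rw [Real.norm_of_nonneg (by positivity)]
    linarith [sq_nonneg ‖p.2‖]
  have hf₀φ : Integrable (fun p => f₀ p * φ (0, p)) :=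
    hf₀i.mul_bdd (hφ.continuous.comp (g := φ) (f := fun p => (0, p)) (by fun_prop)).aestronglyMeasurable
      (Eventually.of_forall fun p => hbφ (0, p))
  obtain ⟨hi1, he1⟩ := integral_integral_freeTransport n hT.le hfD
  obtain ⟨hi2, he2⟩ := integral_integral_freeTransport n hT.le hMfφ
  change -(∫ p, f₀ p * φ (0, p)) - (∫ t in (0:ℝ)..T, ∫ p, Function.uncurry f (t, p) * D (t, p)) =
    (1 / τ) * ∫ t in (0:ℝ)..T, ∫ p, (M (t, p) - Function.uncurry f (t, p)) * φ (t, p)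
  rw [he1, he2, ← integral_neg, ← integral_sub (f := fun p => -(f₀ p * φ (0, p))) hf₀φ.neg hi1,
    ← integral_const_mul]
  apply integral_congr_ae
  have hMS := (measurePreserving_freeTransport n _).integrable_comp_of_integrable hMi
  filter_upwards [hMS.prod_left_ae, ae_characteristic_of_mild n hf₀meas hfmeas hMm hmild]
    with p hNp hchar
  have hderiv := hasDerivAt_comp_freeTransport hφ p
  have hψ : ContDiff ℝ 1 fun t : ℝ => φ (freeTransport n (t, p)) :=
    hφ.comp (by unfold freeTransport; fun_prop)
  have hψT : φ (freeTransport n (T, p)) = 0 :=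
    image_eq_zero_of_notMem_tsupport fun h => lt_irrefl T (hφs h).1
  have h := duhamel_by_parts (a := f₀ p) (τ := τ) hT
    (N := fun t => M (freeTransport n (t, p)))
    (g := fun t => Function.uncurry f (freeTransport n (t, p)))
    ((intervalIntegrable_iff_integrableOn_Ioc_of_le hT.le).2 hNp) hψ hψT
    (hchar.mono fun t ht hm => ht hm.1.le)
  simp_rw [fun t => (hderiv t).deriv] at h
  have h0 : freeTransport n (0, p) = (0, p) := by simp [freeTransport]
  rw [h0] at h
  exact h
end
end

section
/- Let n ≥ 1 be an integer, γ ∈ (1,(n+2)/n) and κ > 0. For every ρ ∈ [0,∞) and u ∈ ℝⁿ: (i) ∫_{ℝⁿ} M[ρ,u](v) dv = ρ; (ii) ∫_{ℝⁿ} v M[ρ,u](v) dv = ρu; (iii) ∫_{ℝⁿ} (v ⊗ v) M[ρ,u](v) dv = ρ u ⊗ u + κ ρ^γ Id, where Id is the n×n identity matrix; and (iv) the compatibility condition ∫_{ℝⁿ} H(M[ρ,u](v),v) dv = (1/2) ρ |u|² + (κ/(γ−1)) ρ^γ. -/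
open MeasureTheory Real

noncomputable section

/-- the Maxwellian `M[ρ,u](v) = c₂ (c₁ ρ^{γ-1} - |v-u|²)₊^{d/2}` (case `γ < (n+2)/n`). -/
def Maxw (n : ℕ) (γ κ ρ : ℝ) (u v : En n) : ℝ :=
  cc2 n γ κ * (max (cc1 γ κ * ρ ^ (γ - 1) - ‖v - u‖ ^ 2) 0) ^ (dof n γ / 2)

/-- kinetic entropy `H(y,v) = |v|² y/2 + (1/(2 c₂^{2/d})) y^{1+2/d}/(1+2/d)`. -/
def kinEnt (n : ℕ) (γ κ y : ℝ) (v : En n) : ℝ :=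
  ‖v‖ ^ 2 * y / 2 +
    (1 / (2 * cc2 n γ κ ^ (2 / dof n γ))) * y ^ (1 + 2 / dof n γ) / (1 + 2 / dof n γ)

open Set in
/-- The beta integral on `(0, a)`, written over `(0, ∞)` with a truncated power. -/
lemma integral_rpow_mul_max_sub_rpow {a s t : ℝ} (ha : 0 < a) (hs : 0 < s) (ht : 0 < t) :
    ∫ x in Ioi (0 : ℝ), x ^ (s - 1) * (max (a - x) 0) ^ t =
      a ^ (s + t) * (Gamma s * Gamma (t + 1) / Gamma (s + t + 1)) := by
  have hrestrict : ∫ x in Ioi (0 : ℝ), x ^ (s - 1) * (max (a - x) 0) ^ t =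
      ∫ x in (0 : ℝ)..a, x ^ (s - 1) * (a - x) ^ t := by
    rw [intervalIntegral.integral_of_le ha.le]
    refine (setIntegral_eq_of_subset_of_forall_sdiff_eq_zero (s := Ioc 0 a) measurableSet_Ioi
      (fun x hx => hx.1) fun x hx => ?_).trans
      (setIntegral_congr_fun measurableSet_Ioc fun x hx => by
        simp only [max_eq_left (sub_nonneg.2 hx.2)])
    have hxa : a ≤ x := by
      by_contra! h
      exact hx.2 ⟨hx.1, h.le⟩
    rw [max_eq_right (sub_nonpos.2 hxa), zero_rpow ht.ne', mul_zero]
  have hbeta := Complex.betaIntegral_scaled (s : ℂ) ((t + 1 : ℝ) : ℂ) ha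
  have hcast : ∫ x in (0 : ℝ)..a, (x : ℂ) ^ ((s : ℂ) - 1) *
      ((a : ℂ) - x) ^ (((t + 1 : ℝ) : ℂ) - 1) =
      ((∫ x in (0 : ℝ)..a, x ^ (s - 1) * (a - x) ^ t : ℝ) : ℂ) := by
    rw [← intervalIntegral.integral_ofReal]
    refine intervalIntegral.integral_congr fun x hx => ?_
    rw [uIcc_of_le ha.le] at hx
    rw [Complex.ofReal_mul, Complex.ofReal_cpow hx.1, Complex.ofReal_cpow (sub_nonneg.2 hx.2)]
    push_cast
    ring_nf
  rw [hcast, Complex.betaIntegral_eq_Gamma_mul_div _ _ (by simpa using hs)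
    (by simp; linarith)] at hbeta
  rw [hrestrict]
  have hexp : (s : ℂ) + ((t + 1 : ℝ) : ℂ) - 1 = ((s + t : ℝ) : ℂ) := by push_cast; ring
  have hsum : (s : ℂ) + ((t + 1 : ℝ) : ℂ) = ((s + t + 1 : ℝ) : ℂ) := by push_cast; ring
  rw [hexp, hsum, Complex.Gamma_ofReal, Complex.Gamma_ofReal, Complex.Gamma_ofReal,
    ← Complex.ofReal_cpow ha.le] at hbeta
  exact_mod_cast hbeta

/-- The truncated power `w ↦ (a - |w|²)₊ ^ s`. -/
def truncPow (n : ℕ) (a s : ℝ) (w : En n) : ℝ := (max (a - ‖w‖ ^ 2) 0) ^ s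

section truncPow

variable {n : ℕ} {a s : ℝ}

lemma continuous_truncPow (hs : 0 < s) : Continuous (truncPow n a s) := by
  unfold truncPow
  exact Continuous.rpow_const (by fun_prop) fun _ => Or.inr hs.le

lemma hasCompactSupport_truncPow (hs : 0 < s) : HasCompactSupport (truncPow n a s) := by
  refine HasCompactSupport.intro (isCompact_closedBall (0 : En n) (√a)) fun w hw => ?_
  have hw' : a ≤ ‖w‖ ^ 2 := by
    have : √a < ‖w‖ := by simpa using hw
    exact ((Real.sqrt_lt' ((Real.sqrt_nonneg a).trans_lt this)).1 this).le
  rw [truncPow, max_eq_right (sub_nonpos.2 hw'), zero_rpow hs.ne']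

lemma integrable_truncPow_smul {E : Type*} [NormedAddCommGroup E] [NormedSpace ℝ E]
    (hs : 0 < s) {f : En n → E} (hf : Continuous f) :
    Integrable fun w => truncPow n a s w • f w :=
  ((continuous_truncPow hs).smul hf).integrable_of_hasCompactSupport
    (hasCompactSupport_truncPow hs).smul_right

lemma integrable_truncPow_mul (hs : 0 < s) {f : En n → ℝ} (hf : Continuous f) :
    Integrable fun w => truncPow n a s w * f w :=
  integrable_truncPow_smul hs hf

lemma integrable_truncPow (hs : 0 < s) : Integrable (truncPow n a s) := by
  simpa using integrable_truncPow_mul (n := n) (a := a) hs (continuous_const (y := (1 : ℝ)))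

lemma truncPow_isometry (e : En n ≃ₗᵢ[ℝ] En n) (w : En n) :
    truncPow n a s (e w) = truncPow n a s w := by
  simp [truncPow]

lemma truncPow_neg (w : En n) : truncPow n a s (-w) = truncPow n a s w := by
  simp [truncPow]

lemma truncPow_nonneg (w : En n) : 0 ≤ truncPow n a s w := by
  unfold truncPow; positivity

lemma truncPow_add_one (hs : 0 < s) (w : En n) :
    truncPow n a (s + 1) w = truncPow n a s w * (a - ‖w‖ ^ 2) := by
  unfold truncPow
  rcases le_total (a - ‖w‖ ^ 2) 0 with h | h
  · rw [max_eq_right h, zero_rpow hs.ne', zero_rpow (by linarith), zero_mul]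
  · rw [max_eq_left h, rpow_add_one' h (by linarith)]

lemma truncPow_rpow {r : ℝ} (w : En n) : truncPow n a s w ^ r = truncPow n a (s * r) w := by
  unfold truncPow
  rw [rpow_mul (le_max_right _ _)]

lemma integral_comp_isometry (e : En n ≃ₗᵢ[ℝ] En n) (f : En n → ℝ) :
    ∫ w, f (e w) = ∫ w, f w :=
  e.measurePreserving.integral_comp e.toHomeomorph.measurableEmbedding f

open Set in
lemma integral_truncPow (hn : 1 ≤ n) (ha : 0 ≤ a) (hs : 0 < s) :
    ∫ w, truncPow n a s w =
      a ^ ((n : ℝ) / 2 + s) * (π ^ ((n : ℝ) / 2) * Gamma (s + 1) / Gamma ((n : ℝ) / 2 + s + 1)) := by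
  have hn0 : (0 : ℝ) < n := by exact_mod_cast hn
  rcases ha.eq_or_lt with rfl | ha
  · have h0 : ∀ w, truncPow n 0 s w = 0 := fun w => by
      rw [truncPow, max_eq_right (by nlinarith [sq_nonneg ‖w‖]), zero_rpow hs.ne']
    simp only [h0, integral_zero]
    rw [zero_rpow (by positivity), zero_mul]
  have : Nonempty (Fin n) := ⟨⟨0, hn⟩⟩
  have : Nontrivial (En n) := by
    apply Module.nontrivial_of_finrank_pos (R := ℝ)
    simpa using (show 0 < n by omega)
  have hpolar := integral_fun_norm_addHaar (volume : Measure (En n))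
    fun r : ℝ => (max (a - r ^ 2) 0) ^ s
  have hradial : ∫ y in Ioi (0 : ℝ), y ^ (n - 1) * (max (a - y ^ 2) 0) ^ s =
      (1 / 2) * ∫ x in Ioi (0 : ℝ), x ^ ((n : ℝ) / 2 - 1) * (max (a - x) 0) ^ s := by
    rw [← integral_comp_rpow_Ioi_of_pos (p := 2)
      (g := fun x => x ^ ((n : ℝ) / 2 - 1) * (max (a - x) 0) ^ s) (by norm_num), ← integral_const_mul]
    refine setIntegral_congr_fun measurableSet_Ioi fun y hy => ?_
    have hy : 0 < y := hy
    have hpow : y ^ (n - 1) = y * (y ^ (2 : ℝ)) ^ ((n : ℝ) / 2 - 1) := by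
      rw [← rpow_mul hy.le, ← rpow_natCast, Nat.cast_sub hn]
      nth_rewrite 2 [← rpow_one y]
      rw [← rpow_add hy]
      congr 1; push_cast; ring
    simp only [smul_eq_mul]
    rw [hpow, rpow_two, show (2 : ℝ) - 1 = 1 by norm_num, rpow_one]
    ring
  have hvol : volume.real (Metric.ball (0 : En n) 1) =
      π ^ ((n : ℝ) / 2) / Gamma ((n : ℝ) / 2 + 1) := by
    have hG : 0 < Gamma ((n : ℝ) / 2 + 1) := Gamma_pos_of_pos (by positivity)
    rw [Measure.real, EuclideanSpace.volume_ball]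
    simp only [Fintype.card_fin, ENNReal.ofReal_one, one_pow, one_mul]
    rw [ENNReal.toReal_ofReal (by positivity), sqrt_eq_rpow, ← rpow_natCast, ← rpow_mul pi_pos.le]
    ring_nf
  simp only [finrank_euclideanSpace, Fintype.card_fin, nsmul_eq_mul, smul_eq_mul] at hpolar
  unfold truncPow
  rw [hpolar, hradial, integral_rpow_mul_max_sub_rpow ha (by positivity) hs, hvol,
    Gamma_add_one (by positivity)]
  have hG : Gamma ((n : ℝ) / 2) ≠ 0 := (Gamma_pos_of_pos (by positivity)).ne'
  field_simp

lemma integral_truncPow_add_one (hn : 1 ≤ n) (ha : 0 ≤ a) (hs : 0 < s) :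
    ∫ w, truncPow n a (s + 1) w =
      a * ((s + 1) / ((n : ℝ) / 2 + s + 1)) * ∫ w, truncPow n a s w := by
  have hn0 : (0 : ℝ) < n := by exact_mod_cast hn
  have hG : Gamma ((n : ℝ) / 2 + s + 1) ≠ 0 := (Gamma_pos_of_pos (by positivity)).ne'
  rw [integral_truncPow hn ha hs, integral_truncPow hn ha (by positivity), ← add_assoc,
    rpow_add_one' ha (by positivity), Gamma_add_one (s := s + 1) (by positivity),
    Gamma_add_one (s := (n : ℝ) / 2 + s + 1) (by positivity)]
  field_simp

lemma integral_truncPow_mul_norm_sq (hn : 1 ≤ n) (ha : 0 ≤ a) (hs : 0 < s) :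
    ∫ w, truncPow n a s w * ‖w‖ ^ 2 =
      a * ((n : ℝ) / 2 / ((n : ℝ) / 2 + s + 1)) * ∫ w, truncPow n a s w := by
  have h : ∫ w, truncPow n a (s + 1) w =
      (∫ w, truncPow n a s w * a) - ∫ w, truncPow n a s w * ‖w‖ ^ 2 := by
    rw [← integral_sub (integrable_truncPow_mul hs continuous_const)
      (integrable_truncPow_mul hs (by fun_prop))]
    exact integral_congr_ae (.of_forall fun w => by
      simp only [truncPow_add_one hs w]; ring)
  rw [integral_truncPow_add_one hn ha hs, integral_mul_const] at h
  have hpos : (0 : ℝ) < (n : ℝ) / 2 + s + 1 := by positivity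
  have : ∫ w, truncPow n a s w * ‖w‖ ^ 2 = (∫ w, truncPow n a s w) * a -
      a * ((s + 1) / ((n : ℝ) / 2 + s + 1)) * ∫ w, truncPow n a s w := by linarith
  rw [this]
  field_simp
  ring

lemma integral_truncPow_smul_id : ∫ w, truncPow n a s w • w = 0 := by
  have h := integral_neg_eq_self (fun w : En n => truncPow n a s w • w) volume
  simp only [truncPow_neg, smul_neg, integral_neg] at h
  have h2 : (2 : ℝ) • ∫ w, truncPow n a s w • w = 0 := by
    rw [two_smul]; exact eq_neg_iff_add_eq_zero.1 h.symm
  exact (smul_eq_zero.1 h2).resolve_left two_ne_zero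

lemma integral_truncPow_mul_of_odd {f : En n → ℝ} (hf : ∀ w, f (-w) = -f w) :
    ∫ w, truncPow n a s w * f w = 0 := by
  have h := integral_neg_eq_self (fun w : En n => truncPow n a s w * f w) volume
  simp only [truncPow_neg, hf, mul_neg, integral_neg] at h
  exact self_eq_neg.1 h.symm

lemma integral_truncPow_mul_coord_mul_coord_of_ne {i j : Fin n} (hij : i ≠ j) :
    ∫ w, truncPow n a s w * (w i * w j) = 0 := by
  let e : En n ≃ₗᵢ[ℝ] En n := LinearIsometryEquiv.piLpCongrRight 2 fun k =>
    if k = i then LinearIsometryEquiv.neg ℝ else LinearIsometryEquiv.refl ℝ ℝ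
  have h := integral_comp_isometry e fun w => truncPow n a s w * (w i * w j)
  have hi : ∀ w, e w i = -w i := fun w => by simp [e]
  have hj : ∀ w, e w j = w j := fun w => by simp [e, hij.symm]
  simp only [truncPow_isometry, hi, hj, neg_mul, mul_neg, integral_neg] at h
  exact self_eq_neg.1 h.symm

lemma integral_truncPow_mul_coord_sq_eq (i j : Fin n) :
    ∫ w, truncPow n a s w * (w i * w i) = ∫ w, truncPow n a s w * (w j * w j) := by
  let e : En n ≃ₗᵢ[ℝ] En n := LinearIsometryEquiv.piLpCongrLeft 2 ℝ ℝ (Equiv.swap i j)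
  have h := integral_comp_isometry e fun w => truncPow n a s w * (w j * w j)
  have hj : ∀ w, e w j = w i := fun w => by
    simp [e, LinearIsometryEquiv.piLpCongrLeft_apply]
  simpa only [truncPow_isometry, hj] using h

lemma integral_truncPow_mul_coord_sq (hs : 0 < s) (i : Fin n) :
    n * ∫ w, truncPow n a s w * (w i * w i) = ∫ w, truncPow n a s w * ‖w‖ ^ 2 := by
  simp only [EuclideanSpace.real_norm_sq_eq, Finset.mul_sum]
  simp only [sq]
  rw [integral_finsetSum _ fun k _ => integrable_truncPow_mul hs (by fun_prop)]
  rw [Finset.sum_congr rfl fun k _ => integral_truncPow_mul_coord_sq_eq k i]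
  simp

end truncPow

section Maxwellian

variable {n : ℕ} {γ κ ρ : ℝ}

lemma dof_half_add (n : ℕ) (γ : ℝ) : (n : ℝ) / 2 + dof n γ / 2 = 1 / (γ - 1) := by
  unfold dof; ring

lemma dof_pos (hn : 1 ≤ n) (hγ1 : 1 < γ) (hγ2 : γ < ((n : ℝ) + 2) / n) : 0 < dof n γ := by
  have hn0 : (0 : ℝ) < n := by exact_mod_cast hn
  rw [lt_div_iff₀ hn0] at hγ2
  rw [dof, sub_pos, lt_div_iff₀ (sub_pos.2 hγ1)]
  linarith

lemma cc1_pos (hγ1 : 1 < γ) (hκ : 0 < κ) : 0 < cc1 γ κ := by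
  have := sub_pos.2 hγ1
  unfold cc1; positivity

lemma cc2_pos (hγ1 : 1 < γ) (hκ : 0 < κ) (hd : 0 < dof n γ) : 0 < cc2 n γ κ := by
  have := sub_pos.2 hγ1
  have := Gamma_pos_of_pos (s := γ / (γ - 1)) (by positivity)
  have := Gamma_pos_of_pos (s := dof n γ / 2 + 1) (by positivity)
  unfold cc2; positivity

lemma Maxw_eq (u v : En n) : Maxw n γ κ ρ u v =
    cc2 n γ κ * truncPow n (cc1 γ κ * ρ ^ (γ - 1)) (dof n γ / 2) (v - u) := rfl

lemma cc2_mul_integral_truncPow (hn : 1 ≤ n) (hγ1 : 1 < γ) (hκ : 0 < κ) (hd : 0 < dof n γ)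
    (hρ : 0 ≤ ρ) :
    cc2 n γ κ * ∫ w, truncPow n (cc1 γ κ * ρ ^ (γ - 1)) (dof n γ / 2) w = ρ := by
  have hγ := sub_pos.2 hγ1
  have hc := cc1_pos hγ1 hκ
  have hG1 := Gamma_pos_of_pos (s := γ / (γ - 1)) (by positivity)
  have hG2 := Gamma_pos_of_pos (s := dof n γ / 2 + 1) (by positivity)
  have hexp : 1 / (γ - 1) + 1 = γ / (γ - 1) := by field_simp; ring
  have hpow : (cc1 γ κ * ρ ^ (γ - 1)) ^ (1 / (γ - 1)) = cc1 γ κ ^ (1 / (γ - 1)) * ρ := by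
    rw [mul_rpow hc.le (by positivity), ← rpow_mul hρ, mul_one_div_cancel hγ.ne', rpow_one]
  rw [integral_truncPow hn (by positivity) (by positivity), dof_half_add, hexp, hpow, cc2,
    ← cc1, rpow_neg hc.le]
  field_simp

lemma cc2_mul_integral_truncPow_mul_norm_sq (hn : 1 ≤ n) (hγ1 : 1 < γ) (hκ : 0 < κ)
    (hd : 0 < dof n γ) (hρ : 0 ≤ ρ) :
    cc2 n γ κ * ∫ w, truncPow n (cc1 γ κ * ρ ^ (γ - 1)) (dof n γ / 2) w * ‖w‖ ^ 2 =
      n * (κ * ρ ^ γ) := by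
  have hγ := sub_pos.2 hγ1
  have hc := cc1_pos hγ1 hκ
  have hρpow : ρ ^ γ = ρ ^ (γ - 1) * ρ := by
    rw [← rpow_add_one' hρ (by linarith), sub_add_cancel]
  have hmass := cc2_mul_integral_truncPow hn hγ1 hκ hd hρ
  rw [integral_truncPow_mul_norm_sq hn (by positivity) (by positivity), dof_half_add,
    mul_left_comm, hmass, hρpow, cc1]
  have : 1 / (γ - 1) + 1 = γ / (γ - 1) := by field_simp; ring
  rw [this]
  field_simp

lemma cc2_mul_integral_truncPow_add_one (hn : 1 ≤ n) (hγ1 : 1 < γ) (hκ : 0 < κ)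
    (hd : 0 < dof n γ) (hρ : 0 ≤ ρ) :
    cc2 n γ κ * ∫ w, truncPow n (cc1 γ κ * ρ ^ (γ - 1)) (dof n γ / 2 + 1) w =
      (dof n γ + 2) * (κ * ρ ^ γ) := by
  have hγ := sub_pos.2 hγ1
  have hc := cc1_pos hγ1 hκ
  have hρpow : ρ ^ γ = ρ ^ (γ - 1) * ρ := by
    rw [← rpow_add_one' hρ (by linarith), sub_add_cancel]
  have hmass := cc2_mul_integral_truncPow hn hγ1 hκ hd hρ
  rw [integral_truncPow_add_one hn (by positivity) (by positivity), dof_half_add,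
    mul_left_comm, hmass, hρpow, cc1]
  have : 1 / (γ - 1) + 1 = γ / (γ - 1) := by field_simp; ring
  rw [this]
  field_simp

lemma cc2_mul_integral_truncPow_mul_coord (hn : 1 ≤ n) (hγ1 : 1 < γ) (hκ : 0 < κ)
    (hd : 0 < dof n γ) (hρ : 0 ≤ ρ) (i j : Fin n) :
    cc2 n γ κ * ∫ w, truncPow n (cc1 γ κ * ρ ^ (γ - 1)) (dof n γ / 2) w * (w i * w j) =
      κ * ρ ^ γ * (if i = j then 1 else 0) := by
  split_ifs with h
  · subst h
    have hn0 : (n : ℝ) ≠ 0 := by exact_mod_cast (by omega : n ≠ 0)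
    apply mul_left_cancel₀ hn0
    rw [mul_left_comm, integral_truncPow_mul_coord_sq (by positivity),
      cc2_mul_integral_truncPow_mul_norm_sq hn hγ1 hκ hd hρ, mul_one]
  · rw [integral_truncPow_mul_coord_mul_coord_of_ne h, mul_zero, mul_zero]

/-- The internal part of the entropy of a Maxwellian is again a truncated power. -/
lemma Maxw_rpow_eq (hγ1 : 1 < γ) (hκ : 0 < κ) (hd : 0 < dof n γ) (u v : En n) :
    (1 / (2 * cc2 n γ κ ^ (2 / dof n γ))) * Maxw n γ κ ρ u v ^ (1 + 2 / dof n γ) /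
      (1 + 2 / dof n γ) =
    cc2 n γ κ / (2 * (1 + 2 / dof n γ)) *
      truncPow n (cc1 γ κ * ρ ^ (γ - 1)) (dof n γ / 2 + 1) (v - u) := by
  have hc := cc2_pos (n := n) hγ1 hκ hd
  have hexp : dof n γ / 2 * (1 + 2 / dof n γ) = dof n γ / 2 + 1 := by field_simp
  have hcpow := rpow_pos_of_pos hc (2 / dof n γ)
  rw [Maxw_eq, mul_rpow hc.le (truncPow_nonneg _), truncPow_rpow, hexp, rpow_add hc, rpow_one]
  field_simp

end Maxwellian

/-- Moment identities and compatibility condition for the Maxwellian, `γ ∈ (1,(n+2)/n)`: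
`∫ M dv = ρ`, `∫ v M dv = ρu`, `∫ v⊗v M dv = ρ u⊗u + κρ^γ Id`, and
`∫ H(M[ρ,u](v),v) dv = ρ|u|²/2 + κ/(γ-1) ρ^γ`. -/
theorem stmt11 (n : ℕ) (hn : 1 ≤ n) (γ κ : ℝ)
    (hγ1 : 1 < γ) (hγ2 : γ < ((n : ℝ) + 2) / n) (hκ : 0 < κ)
    (ρ : ℝ) (hρ : 0 ≤ ρ) (u : En n) :
    (∫ v : En n, Maxw n γ κ ρ u v) = ρ ∧
    (∫ v : En n, Maxw n γ κ ρ u v • v) = ρ • u ∧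
    (∀ i j : Fin n, (∫ v : En n, v i * v j * Maxw n γ κ ρ u v) =
      ρ * (u i * u j) + κ * ρ ^ γ * (if i = j then 1 else 0)) ∧
    (∫ v : En n, kinEnt n γ κ (Maxw n γ κ ρ u v) v) =
      ρ * ‖u‖ ^ 2 / 2 + κ / (γ - 1) * ρ ^ γ := by
  have hd := dof_pos hn hγ1 hγ2
  have hs : 0 < dof n γ / 2 := by positivity
  have hmass := cc2_mul_integral_truncPow hn hγ1 hκ hd hρ
  have hnorm := cc2_mul_integral_truncPow_mul_norm_sq hn hγ1 hκ hd hρ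
  have hcoord := cc2_mul_integral_truncPow_mul_coord hn hγ1 hκ hd hρ
  have hent := cc2_mul_integral_truncPow_add_one hn hγ1 hκ hd hρ
  have hpow := Maxw_rpow_eq (ρ := ρ) hγ1 hκ hd
  simp only [kinEnt, hpow]
  simp only [Maxw_eq]
  set a := cc1 γ κ * ρ ^ (γ - 1)
  set s := dof n γ / 2
  set c := cc2 n γ κ
  refine ⟨?_, ?_, fun i j => ?_, ?_⟩
  · rw [integral_const_mul, integral_sub_right_eq_self (truncPow n a s) u, hmass]
  · rw [← integral_add_right_eq_self _ u]
    simp only [add_sub_cancel_right, mul_smul, smul_add]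
    rw [integral_add ((integrable_truncPow_smul hs continuous_id').fun_smul c)
      ((integrable_truncPow_smul hs continuous_const).fun_smul c), integral_smul, integral_smul,
      integral_truncPow_smul_id, integral_smul_const, smul_zero, zero_add, smul_smul, hmass]
  · rw [← integral_add_right_eq_self _ u]
    have hexpand : ∀ w : En n, (w + u) i * (w + u) j * (c * truncPow n a s (w + u - u)) =
        c * (truncPow n a s w * (w i * w j) + truncPow n a s w * (w i * u j + u i * w j) +
          truncPow n a s w * (u i * u j)) := fun w => by
      simp only [add_sub_cancel_right, PiLp.add_apply]; ring
    simp only [hexpand]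
    have i1 := integrable_truncPow_mul (n := n) (a := a) hs (f := fun w => w i * w j) (by fun_prop)
    have i2 := integrable_truncPow_mul (n := n) (a := a) hs
      (f := fun w => w i * u j + u i * w j) (by fun_prop)
    have i3 := integrable_truncPow_mul (n := n) (a := a) hs
      (f := fun _ => u i * u j) (by fun_prop)
    rw [integral_const_mul, integral_add (i1.fun_add i2) i3, integral_add i1 i2,
      integral_truncPow_mul_of_odd (f := fun w => w i * u j + u i * w j)
        (fun w => by simp only [PiLp.neg_apply]; ring),
      integral_mul_const, mul_add, mul_add, hcoord, mul_zero, ← mul_assoc, hmass]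
    ring
  · rw [← integral_add_right_eq_self _ u]
    have hexpand : ∀ w : En n, ‖w + u‖ ^ 2 * (c * truncPow n a s (w + u - u)) / 2 +
          c / (2 * (1 + 2 / dof n γ)) * truncPow n a (s + 1) (w + u - u) =
        c / 2 * (truncPow n a s w * ‖w‖ ^ 2 + truncPow n a s w * (2 * inner ℝ w u) +
          truncPow n a s w * ‖u‖ ^ 2) +
        c / (2 * (1 + 2 / dof n γ)) * truncPow n a (s + 1) w := fun w => by
      simp only [add_sub_cancel_right, norm_add_sq_real]; ring
    simp only [hexpand]
    have i1 := integrable_truncPow_mul (n := n) (a := a) hs (f := fun w => ‖w‖ ^ 2) (by fun_prop)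
    have i2 := integrable_truncPow_mul (n := n) (a := a) hs
      (f := fun w => 2 * inner ℝ w u) (by fun_prop)
    have i3 := integrable_truncPow_mul (n := n) (a := a) hs
      (f := fun _ => ‖u‖ ^ 2) (by fun_prop)
    have i4 := integrable_truncPow (n := n) (a := a) (s := s + 1) (by positivity)
    rw [integral_add (((i1.fun_add i2).fun_add i3).const_mul _) (i4.const_mul _), integral_const_mul,
      integral_const_mul, integral_add (i1.fun_add i2) i3, integral_add i1 i2,
      integral_truncPow_mul_of_odd (f := fun w => 2 * inner ℝ w u)
        (fun w => by simp only [inner_neg_left]; ring), integral_mul_const]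
    have hdof : κ / (γ - 1) = κ * (n / 2 + dof n γ / 2) := by rw [dof_half_add]; ring
    have hfrac : c / (2 * (1 + 2 / dof n γ)) * ∫ w, truncPow n a (s + 1) w =
        dof n γ / 2 * (κ * ρ ^ γ) := by
      rw [show c / (2 * (1 + 2 / dof n γ)) * ∫ w, truncPow n a (s + 1) w =
        (c * ∫ w, truncPow n a (s + 1) w) / (2 * (1 + 2 / dof n γ)) by ring, hent]
      field_simp
    rw [hfrac, hdof]
    linear_combination hnorm / 2 + ‖u‖ ^ 2 / 2 * hmass
end
end

section
/- Let n ≥ 1 be an integer, γ ∈ (1,(n+2)/n) and κ > 0, and define Λ(γ,κ) = (2/√π) · ( (1/(γ−1)) Γ(1/(γ−1)) / Γ(1/(γ−1) + 1/2) ) · ( (γ−1)^{1/2} / (2γκ)^{1/2} ). Then for every ρ ∈ [0,∞) and all u₁, u₂ ∈ ℝⁿ, ∫_{ℝⁿ} | M[ρ,u₁](v) − M[ρ,u₂](v) | dv ≤ Λ(γ,κ) · ρ^{1 − (γ−1)/2} · |u₁ − u₂|. -/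
open MeasureTheory Real

noncomputable section

/-- the constant `Λ(γ,κ) = (2/√π) · ((1/(γ-1))Γ(1/(γ-1))/Γ(1/(γ-1)+1/2)) · ((γ-1)^{1/2}/(2γκ)^{1/2})`. -/
def Lam (γ κ : ℝ) : ℝ :=
  2 / Real.sqrt Real.pi *
    ((1 / (γ - 1)) * Real.Gamma (1 / (γ - 1)) / Real.Gamma (1 / (γ - 1) + 1 / 2)) *
    ((γ - 1) ^ ((1:ℝ) / 2) / (2 * γ * κ) ^ ((1:ℝ) / 2))

open Set

/-- The profile `t ↦ (S - t²)₊^α` is continuous. -/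
lemma continuous_max_sub_sq_rpow {α : ℝ} (hα : 0 < α) (S : ℝ) :
    Continuous fun t : ℝ => (max (S - t ^ 2) 0) ^ α :=
  ((continuous_const.sub (continuous_pow 2)).max continuous_const).rpow_const
    fun _ => Or.inr hα.le

lemma integrable_max_sub_sq_rpow {α : ℝ} (hα : 0 < α) (S : ℝ) :
    Integrable fun t : ℝ => (max (S - t ^ 2) 0) ^ α := by
  refine (continuous_max_sub_sq_rpow hα S).integrable_of_hasCompactSupport ?_
  refine HasCompactSupport.intro (isCompact_Icc (a := -(|S| + 1)) (b := |S| + 1)) fun t ht => ?_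
  have h : S - t ^ 2 ≤ 0 := by
    by_contra! h
    have h1 : t ^ 2 < (|S| + 1) ^ 2 := by nlinarith [le_abs_self S, abs_nonneg S]
    exact ht (abs_le.1 ((abs_lt_of_sq_lt_sq h1 (by positivity)).le))
  rw [max_eq_right h, Real.zero_rpow hα.ne']

lemma integral_max_sub_sq_rpow {α : ℝ} (hα : 0 < α) (S : ℝ) :
    ∫ t : ℝ, (max (S - t ^ 2) 0) ^ α =
      √π * Real.Gamma (α + 1) / Real.Gamma (α + 1 + 1 / 2) * (max S 0) ^ (α + 1 / 2) := by
  rcases le_or_gt S 0 with hS | hS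
  · have h : ∀ t : ℝ, (max (S - t ^ 2) 0) ^ α = 0 := fun t => by
      rw [max_eq_right (by nlinarith [sq_nonneg t]), Real.zero_rpow hα.ne']
    simp only [h, integral_zero]
    rw [max_eq_right hS, Real.zero_rpow (by positivity), mul_zero]
  have hα1 : 0 < α + 1 := by positivity
  set B := ProbabilityTheory.beta (α + 1) (α + 1) with hB
  have hBpos : 0 < B := ProbabilityTheory.beta_pos hα1 hα1
  set p := ProbabilityTheory.betaPDFReal (α + 1) (α + 1) with hp
  have hp1 : ∫ x, p x = 1 := by
    rw [integral_eq_lintegral_of_nonneg_ae]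
    · have := ProbabilityTheory.lintegral_betaPDF_eq_one hα1 hα1
      simp only [ProbabilityTheory.betaPDF] at this
      rw [this]; simp
    · refine Filter.Eventually.of_forall fun x => ?_
      by_cases h : 0 < x ∧ x < 1
      · exact (ProbabilityTheory.betaPDFReal_pos h.1 h.2 hα1 hα1).le
      · simp [hp, ProbabilityTheory.betaPDFReal, h]
    · exact (ProbabilityTheory.measurable_betaPDFReal _ _).aestronglyMeasurable
  have hsq : 0 < √S := Real.sqrt_pos.2 hS
  have hSS : √S ^ 2 = S := Real.sq_sqrt hS.le
  have key : ∀ t : ℝ, (max (S - t ^ 2) 0) ^ α =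
      (4 * S) ^ α * B * p ((2 * √S)⁻¹ * t + 1 / 2) := fun t => by
    set x := (2 * √S)⁻¹ * t + 1 / 2 with hx
    have ht : t = √S * (2 * x - 1) := by rw [hx]; field_simp; ring
    have hSt : S - t ^ 2 = 4 * S * (x * (1 - x)) := by
      rw [ht, mul_pow, hSS]; ring
    rw [hSt, hp, ProbabilityTheory.betaPDFReal]
    split_ifs with h
    · have h1 : 0 < 1 - x := by linarith [h.2]
      have h0 := h.1
      rw [max_eq_left (by positivity), Real.mul_rpow (by positivity) (by positivity),
        Real.mul_rpow h0.le h1.le, ← hB]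
      simp only [add_sub_cancel_right]
      field_simp
    · have h2 : x * (1 - x) ≤ 0 := by
        rcases le_or_gt x 0 with h0 | h0
        · nlinarith
        · have : 1 ≤ x := by by_contra! h'; exact h ⟨h0, h'⟩
          nlinarith
      rw [max_eq_right (by nlinarith), Real.zero_rpow hα.ne', mul_zero]
  simp_rw [key]
  rw [integral_const_mul, Measure.integral_comp_mul_left (fun y => p (y + 1 / 2)),
    integral_add_right_eq_self p, hp1, max_eq_left hS.le, inv_inv, abs_of_pos (by positivity)]
  have hdup := Real.Gamma_mul_Gamma_add_half (α + 1)
  have hG := Real.Gamma_pos_of_pos hα1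
  have hG1 : 0 < Real.Gamma (α + 1 + 1 / 2) := Real.Gamma_pos_of_pos (by positivity)
  have hG2 : 0 < Real.Gamma (2 * (α + 1)) := Real.Gamma_pos_of_pos (by positivity)
  have h4 : (4 : ℝ) ^ α * 2 * 2 ^ (1 - 2 * (α + 1)) = 1 := by
    rw [show (4 : ℝ) = 2 ^ (2 : ℝ) by norm_num, ← Real.rpow_mul (by norm_num), mul_assoc,
      ← Real.rpow_one_add' (by norm_num) (by linarith), ← Real.rpow_add (by norm_num),
      show 2 * α + (1 + (1 - 2 * (α + 1))) = 0 by ring, Real.rpow_zero]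
  rw [hB, ProbabilityTheory.beta, ← two_mul, Real.mul_rpow (by norm_num) hS.le,
    Real.rpow_add hS, ← Real.sqrt_eq_rpow, smul_eq_mul, mul_one]
  rw [div_mul_eq_mul_div, eq_div_iff hG1.ne', mul_div_assoc', div_mul_eq_mul_div,
    div_mul_eq_mul_div, div_eq_iff hG2.ne']
  linear_combination (4 ^ α * S ^ α * Real.Gamma (α + 1) * 2 * √S) * hdup +
    (S ^ α * Real.Gamma (α + 1) * √S * Real.Gamma (2 * (α + 1)) * √π) * h4

lemma lintegral_max_sub_sq_rpow {α : ℝ} (hα : 0 < α) (S : ℝ) :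
    ∫⁻ t : ℝ, ENNReal.ofReal ((max (S - t ^ 2) 0) ^ α) =
      ENNReal.ofReal (√π * Real.Gamma (α + 1) / Real.Gamma (α + 1 + 1 / 2)) *
        ENNReal.ofReal ((max S 0) ^ (α + 1 / 2)) := by
  have hG := Real.Gamma_pos_of_pos (show 0 < α + 1 by positivity)
  have hG1 := Real.Gamma_pos_of_pos (show 0 < α + 1 + 1 / 2 by positivity)
  rw [← ofReal_integral_eq_lintegral_ofReal (integrable_max_sub_sq_rpow hα S)
    (Filter.Eventually.of_forall fun t => Real.rpow_nonneg (le_max_right _ _) _),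
    integral_max_sub_sq_rpow hα, ENNReal.ofReal_mul (by positivity)]

/-- Integral of `(S - |w|²)₊^α` over `ℝᵐ`. -/
lemma lintegral_max_sub_sum_sq_rpow (m : ℕ) {α : ℝ} (hα : 0 < α) (S : ℝ) :
    ∫⁻ w : Fin m → ℝ, ENNReal.ofReal ((max (S - ∑ i, w i ^ 2) 0) ^ α) =
      ENNReal.ofReal (π ^ ((m : ℝ) / 2) * Real.Gamma (α + 1) / Real.Gamma (α + 1 + m / 2)) *
        ENNReal.ofReal ((max S 0) ^ (α + m / 2)) := by
  induction m generalizing α with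
  | zero =>
    have hG := Real.Gamma_pos_of_pos (show 0 < α + 1 by positivity)
    have : (volume : Measure (Fin 0 → ℝ)) = Measure.dirac 0 := by
      rw [volume_pi, Measure.pi_of_empty _ 0]
    rw [this, lintegral_dirac]
    simp [hG.ne']
  | succ m ih =>
    have hF : Measurable fun w : Fin (m + 1) → ℝ =>
        ENNReal.ofReal ((max (S - ∑ i, w i ^ 2) 0) ^ α) := by fun_prop
    rw [← ((volume_preserving_piFinSuccAbove (fun _ : Fin (m + 1) => ℝ) 0).symm).lintegral_comp
      hF, Measure.volume_eq_prod,
      lintegral_prod_symm' _ (by exact hF.comp (MeasurableEquiv.measurable _))]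
    have h : ∀ w : Fin m → ℝ, ∀ t : ℝ,
        S - ∑ i, ((MeasurableEquiv.piFinSuccAbove (fun _ : Fin (m + 1) => ℝ) 0).symm (t, w)) i ^ 2
          = (S - ∑ i, w i ^ 2) - t ^ 2 := fun w t => by
      rw [Fin.sum_univ_succ]
      simp [MeasurableEquiv.piFinSuccAbove_symm_apply, Fin.insertNthEquiv]
      ring
    have hG := Real.Gamma_pos_of_pos (show 0 < α + 1 by positivity)
    have hG1 := Real.Gamma_pos_of_pos (show 0 < α + 1 + 1 / 2 by positivity)
    have hG2 := Real.Gamma_pos_of_pos (show 0 < α + 1 + ((m + 1 : ℕ) : ℝ) / 2 by positivity)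
    simp_rw [h, lintegral_max_sub_sq_rpow hα]
    rw [lintegral_const_mul _ (by fun_prop), ih (by positivity), ← mul_assoc,
      ← ENNReal.ofReal_mul (by positivity)]
    have e1 : α + 1 / 2 + 1 = α + 1 + 1 / 2 := by ring
    have e2 : α + 1 / 2 + 1 + (m : ℝ) / 2 = α + 1 + ((m + 1 : ℕ) : ℝ) / 2 := by push_cast; ring
    have e3 : α + 1 / 2 + (m : ℝ) / 2 = α + ((m + 1 : ℕ) : ℝ) / 2 := by push_cast; ring
    have e4 : π ^ (((m + 1 : ℕ) : ℝ) / 2) = π ^ ((m : ℝ) / 2) * √π := by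
      rw [Real.sqrt_eq_rpow, ← Real.rpow_add Real.pi_pos]; push_cast; ring_nf
    rw [e2, e3, e1, e4]
    congr 2
    field_simp

/-- Shifting a symmetric decreasing profile by `a` moves it in `L¹` by at most its total
variation times `a`. -/
lemma lintegral_shift_max_sub_sq_rpow_le {α : ℝ} (hα : 0 < α) (S : ℝ) {a : ℝ} (ha : 0 ≤ a) :
    ∫⁻ t : ℝ, ENNReal.ofReal |(max (S - (t - a) ^ 2) 0) ^ α - (max (S - t ^ 2) 0) ^ α| ≤
      ENNReal.ofReal (2 * a) * ENNReal.ofReal ((max S 0) ^ α) := by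
  set g : ℝ → ℝ := fun t => (max (S - t ^ 2) 0) ^ α with hg
  have hgi : Integrable g := integrable_max_sub_sq_rpow hα S
  have hgs : Integrable fun t => g (t - a) := hgi.comp_sub_right a
  have hmono : ∀ s t : ℝ, s ^ 2 ≤ t ^ 2 → g t ≤ g s := fun s t h => by
    exact Real.rpow_le_rpow (le_max_right _ _) (max_le_max (by linarith) le_rfl) hα.le
  change ∫⁻ t : ℝ, ENNReal.ofReal |g (t - a) - g t| ≤ _
  have hi : Integrable fun t => |g (t - a) - g t| := (hgs.sub hgi).abs
  rw [← ofReal_integral_eq_lintegral_ofReal hi (Filter.Eventually.of_forall fun t => abs_nonneg _),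
    ← ENNReal.ofReal_mul (by positivity)]
  refine ENNReal.ofReal_le_ofReal ?_
  rw [← intervalIntegral.integral_Iic_add_Ioi (b := a / 2) hi.integrableOn hi.integrableOn]
  have h1 : ∫ t in Iic (a / 2), |g (t - a) - g t| = ∫ t in Iic (a / 2), (g t - g (t - a)) := by
    refine setIntegral_congr_fun measurableSet_Iic fun t ht => ?_
    have ht' : t ≤ a / 2 := ht
    have := hmono t (t - a) (by nlinarith)
    rw [abs_of_nonpos (by linarith)]; ring
  have h2 : ∫ t in Ioi (a / 2), |g (t - a) - g t| = ∫ t in Ioi (a / 2), (g (t - a) - g t) := by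
    refine setIntegral_congr_fun measurableSet_Ioi fun t ht => ?_
    have ht' : a / 2 < t := ht
    have := hmono (t - a) t (by nlinarith)
    rw [abs_of_nonneg (by linarith)]
  have h3 : ∫ t in Iic (a / 2), g (t - a) = ∫ t in Iic (a / 2 - a), g t := by
    simpa using ((measurePreserving_sub_right volume a).setIntegral_preimage_emb
      (measurableEmbedding_subRight a) g (Iic (a / 2 - a)))
  have h4 : ∫ t in Ioi (a / 2), g (t - a) = ∫ t in Ioi (a / 2 - a), g t := by
    simpa using ((measurePreserving_sub_right volume a).setIntegral_preimage_emb
      (measurableEmbedding_subRight a) g (Ioi (a / 2 - a)))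
  rw [h1, h2, integral_sub hgi.integrableOn hgs.integrableOn,
    integral_sub hgs.integrableOn hgi.integrableOn, h3, h4,
    intervalIntegral.integral_Iic_sub_Iic hgi.integrableOn hgi.integrableOn,
    intervalIntegral.integral_Ioi_sub_Ioi hgi.integrableOn (by linarith)]
  have h5 : ∫ t in (a / 2 - a)..(a / 2), g t ≤ ∫ t in (a / 2 - a)..(a / 2), g 0 :=
    intervalIntegral.integral_mono_on (by linarith) hgi.intervalIntegrable (by simp)
      fun t _ => hmono 0 t (by nlinarith [sq_nonneg t])
  rw [intervalIntegral.integral_const] at h5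
  have h6 : g 0 = (max S 0) ^ α := by simp [hg]
  rw [h6, smul_eq_mul] at h5
  linarith

/-- `L¹` modulus of translation of `(S - |v|²)₊^α` on `ℝ^(m+1)`. -/
lemma lintegral_shift_max_sub_norm_sq_rpow_le (m : ℕ) {α : ℝ} (hα : 0 < α) (S : ℝ)
    (u₁ u₂ : En (m + 1)) :
    ∫⁻ v : En (m + 1), ENNReal.ofReal
        |(max (S - ‖v - u₁‖ ^ 2) 0) ^ α - (max (S - ‖v - u₂‖ ^ 2) 0) ^ α| ≤
      ENNReal.ofReal (2 * ‖u₁ - u₂‖) *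
        (ENNReal.ofReal (π ^ ((m : ℝ) / 2) * Real.Gamma (α + 1) / Real.Gamma (α + 1 + m / 2)) *
          ENNReal.ofReal ((max S 0) ^ (α + m / 2))) := by
  set a := ‖u₁ - u₂‖ with ha
  set e : En (m + 1) := EuclideanSpace.single 0 a with he
  obtain ⟨L, hL⟩ : ∃ L : En (m + 1) ≃ₗᵢ[ℝ] En (m + 1), L (u₁ - u₂) = e :=
    ⟨_, Submodule.reflection_sub (by simp [he, ha])⟩
  set G : En (m + 1) → ENNReal := fun v => ENNReal.ofReal
    |(max (S - ‖v - e‖ ^ 2) 0) ^ α - (max (S - ‖v‖ ^ 2) 0) ^ α| with hG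
  have hGm : Measurable G := by fun_prop
  have step1 : ∫⁻ v : En (m + 1), ENNReal.ofReal
        |(max (S - ‖v - u₁‖ ^ 2) 0) ^ α - (max (S - ‖v - u₂‖ ^ 2) 0) ^ α| = ∫⁻ v, G v := by
    rw [← L.measurePreserving.lintegral_comp hGm, ← lintegral_add_right_eq_self _ u₂]
    refine lintegral_congr fun v => ?_
    simp only [hG]
    rw [← hL, ← map_sub, L.norm_map, L.norm_map, add_sub_cancel_right, sub_sub_eq_add_sub]
  rw [step1, ← (PiLp.volume_preserving_toLp (Fin (m + 1))).lintegral_comp hGm,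
    ← ((volume_preserving_piFinSuccAbove (fun _ : Fin (m + 1) => ℝ) 0).symm).lintegral_comp
      (by fun_prop), Measure.volume_eq_prod, lintegral_prod_symm' _ (by fun_prop)]
  have h : ∀ w : Fin m → ℝ, ∀ t : ℝ,
      G (WithLp.toLp 2 ((MeasurableEquiv.piFinSuccAbove (fun _ : Fin (m + 1) => ℝ) 0).symm (t, w)))
        = ENNReal.ofReal |(max ((S - ∑ i, w i ^ 2) - (t - a) ^ 2) 0) ^ α -
            (max ((S - ∑ i, w i ^ 2) - t ^ 2) 0) ^ α| := fun w t => by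
    simp only [hG, EuclideanSpace.norm_sq_eq, Fin.sum_univ_succ]
    simp [he, MeasurableEquiv.piFinSuccAbove_symm_apply, Fin.insertNthEquiv]
    ring_nf
  simp_rw [h]
  rw [← lintegral_max_sub_sum_sq_rpow m hα S, ← lintegral_const_mul _ (by fun_prop)]
  exact lintegral_mono fun w => lintegral_shift_max_sub_sq_rpow_le hα _ (norm_nonneg _)

/-- Translation stability of the Maxwellian:
`∫ |M[ρ,u₁] - M[ρ,u₂]| dv ≤ Λ(γ,κ) ρ^{1-(γ-1)/2} |u₁ - u₂|`. -/
theorem stmt17 (n : ℕ) (hn : 1 ≤ n) (γ κ : ℝ)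
    (hγ1 : 1 < γ) (hγ2 : γ < ((n : ℝ) + 2) / n) (hκ : 0 < κ)
    (ρ : ℝ) (hρ : 0 ≤ ρ) (u₁ u₂ : En n) :
    (∫ v : En n, |Maxw n γ κ ρ u₁ v - Maxw n γ κ ρ u₂ v|) ≤
      Lam γ κ * ρ ^ (1 - (γ - 1) / 2) * ‖u₁ - u₂‖ := by
  obtain ⟨m, rfl⟩ : ∃ m, n = m + 1 := ⟨n - 1, by omega⟩
  have hg : 0 < γ - 1 := by linarith
  have hγ0 : 0 < γ := by linarith
  have hd : 0 < dof (m + 1) γ / 2 := by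
    rw [lt_div_iff₀ (by positivity)] at hγ2
    have : ((m + 1 : ℕ) : ℝ) < 2 / (γ - 1) := by
      rw [lt_div_iff₀ hg]; linarith
    unfold dof
    linarith
  set α := dof (m + 1) γ / 2 with hα
  set β := 1 / (γ - 1) with hβ
  have hβ0 : 0 < β := by positivity
  have hαβ : α + m / 2 = β - 1 / 2 := by
    rw [hα, dof, hβ]; push_cast; ring
  have hαβ' : α + 1 + m / 2 = β + 1 / 2 := by linarith
  have hc1 : 0 < cc1 γ κ := by unfold cc1; positivity
  have hG1 := Real.Gamma_pos_of_pos (show 0 < α + 1 by positivity)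
  have hG2 := Real.Gamma_pos_of_pos (show 0 < β + 1 / 2 by positivity)
  have hG3 := Real.Gamma_pos_of_pos hβ0
  have hγβ : γ / (γ - 1) = β + 1 := by rw [hβ]; field_simp; ring
  have hc2 : cc2 (m + 1) γ κ = cc1 γ κ ^ (-β) * (β * Real.Gamma β) /
      (π ^ ((m : ℝ) / 2) * √π * Real.Gamma (α + 1)) := by
    rw [cc2, hγβ, Real.Gamma_add_one hβ0.ne', ← hα, ← hβ, Real.sqrt_eq_rpow,
      ← Real.rpow_add Real.pi_pos, cc1]
    push_cast; ring_nf
  have hc2' : 0 < cc2 (m + 1) γ κ := by rw [hc2]; positivity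
  set S := cc1 γ κ * ρ ^ (γ - 1) with hS
  have hS0 : 0 ≤ S := by positivity
  have hrhs : Lam γ κ * ρ ^ (1 - (γ - 1) / 2) * ‖u₁ - u₂‖ =
      cc2 (m + 1) γ κ * (2 * ‖u₁ - u₂‖ *
        (π ^ ((m : ℝ) / 2) * Real.Gamma (α + 1) / Real.Gamma (α + 1 + m / 2) *
          (max S 0) ^ (α + m / 2))) := by
    have e1 : S ^ (β - 1 / 2) = cc1 γ κ ^ (β - 1 / 2) * ρ ^ (1 - (γ - 1) / 2) := by
      rw [hS, Real.mul_rpow hc1.le (by positivity), ← Real.rpow_mul hρ]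
      congr 2
      rw [hβ]; field_simp
    have e2 : (γ - 1) ^ ((1 : ℝ) / 2) / (2 * γ * κ) ^ ((1 : ℝ) / 2) =
        cc1 γ κ ^ (-β) * cc1 γ κ ^ (β - 1 / 2) := by
      rw [← Real.rpow_add hc1, ← Real.div_rpow hg.le (by positivity),
        show -β + (β - 1 / 2) = -(1 / 2) by ring, Real.rpow_neg hc1.le,
        ← Real.inv_rpow hc1.le, cc1, inv_div]
    rw [max_eq_left hS0, hαβ, hαβ', e1, hc2, Lam, e2, ← hβ]
    field_simp
  rw [integral_eq_lintegral_of_nonneg_ae (Filter.Eventually.of_forall fun v => abs_nonneg _)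
    (by unfold Maxw; exact Measurable.aestronglyMeasurable (by fun_prop))]
  rw [hrhs]
  refine ENNReal.toReal_le_of_le_ofReal (by rw [hαβ']; positivity) ?_
  have h : ∀ v : En (m + 1), ENNReal.ofReal |Maxw (m + 1) γ κ ρ u₁ v - Maxw (m + 1) γ κ ρ u₂ v| =
      ENNReal.ofReal (cc2 (m + 1) γ κ) * ENNReal.ofReal
        |(max (S - ‖v - u₁‖ ^ 2) 0) ^ α - (max (S - ‖v - u₂‖ ^ 2) 0) ^ α| := fun v => by
    rw [← ENNReal.ofReal_mul hc2'.le, Maxw, Maxw, ← mul_sub, abs_mul, abs_of_pos hc2']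
  simp_rw [h]
  rw [lintegral_const_mul _ (by fun_prop), ENNReal.ofReal_mul hc2'.le,
    ENNReal.ofReal_mul (p := 2 * ‖u₁ - u₂‖) (by positivity),
    ENNReal.ofReal_mul (p := π ^ ((m : ℝ) / 2) * Real.Gamma (α + 1) / Real.Gamma (α + 1 + m / 2))
      (by rw [hαβ']; positivity)]
  gcongr
  exact lintegral_shift_max_sub_norm_sq_rpow_le m hd S u₁ u₂
end
end
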